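/- arXiv:1903.10986 — 2 statements merged into one kernel-verified Lean document; each statement's English description precedes it below -/
import Mathlib

section
/- Let F be a finite field, n, k, δ positive integers with δ < k < n so that ν = 1 and t = δ. Let G(z) = G_0 + G_1 z ∈ F[z]^{n×k} where exactly the first δ columns of G_1 are (allowed to be) nonzero, and let 𝒢 ∈ F^{n×(k+δ)} be the matrix with columns g_{0,1}, g_{1,1}, …, g_{0,δ}, g_{1,δ}, g_{0,δ+1}, …, g_{0,k}, where g_{i,r} denotes the r-th column of G_i. If 𝒢 is superregular and n ≥ δ + k − 1, then G(z) is the generator matrix of an MDS convolutional code of rate k/n and degree δ; that is, the free distance of Im_{F[z]} G(z) equals n − k + δ + 1. -/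
open Matrix Polynomial Finset

/-- A matrix over a field is superregular if every minor is nonzero. -/
def Superregular {F : Type*} [Field F] {r ℓ : ℕ} (A : Matrix (Fin r) (Fin ℓ) F) : Prop :=
  ∀ (s : ℕ) (f : Fin s → Fin r) (g : Fin s → Fin ℓ),
    StrictMono f → StrictMono g → (A.submatrix f g).det ≠ 0

/-- The maximal degree of the `k × k` minors of a polynomial matrix `G`. -/
noncomputable def maxMinorDeg {F : Type*} [Field F] {n k : ℕ}
    (G : Matrix (Fin n) (Fin k) (Polynomial F)) : ℕ :=
  Finset.univ.sup fun f : Fin k → Fin n => ((G.submatrix f id).det).natDegree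

/-- The weight of a polynomial vector: the total number of nonzero coefficients. -/
def polyWeight {F : Type*} [Field F] {n : ℕ} (v : Fin n → Polynomial F) : ℕ :=
  ∑ x : Fin n, (v x).support.card

/-- The free distance of the convolutional code generated by `G`: the minimal weight of a
nonzero codeword of `Im_{F[z]} G(z)`. -/
noncomputable def freeDist {F : Type*} [Field F] {n k : ℕ}
    (G : Matrix (Fin n) (Fin k) (Polynomial F)) : ℕ :=
  sInf {w : ℕ | ∃ u : Fin k → Polynomial F, G.mulVec u ≠ 0 ∧ w = polyWeight (G.mulVec u)}

theorem sr_weight {F : Type*} [Field F] [DecidableEq F] {n l : ℕ} (A : Matrix (Fin n) (Fin l) F)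
    (hA : Superregular A) (c : Fin l → F) (hc : c ≠ 0) :
    n + 1 ≤ (univ.filter fun x => A.mulVec c x ≠ 0).card + (univ.filter fun j => c j ≠ 0).card := by
  by_contra hlt
  have hz : (univ.filter fun x => A.mulVec c x = 0).card
      + (univ.filter fun x => ¬ A.mulVec c x = 0).card = n := by
    rw [Finset.card_filter_add_card_filter_not]; simp
  obtain ⟨m, hm⟩ : ∃ m, m = (univ.filter fun j => c j ≠ 0).card := ⟨_, rfl⟩
  have hle : m ≤ (univ.filter fun x => A.mulVec c x = 0).card := by
    simp only [ne_eq] at hlt hm; omega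
  obtain ⟨S, hS, hSc⟩ := Finset.exists_subset_card_eq hle
  set f := S.orderEmbOfFin hSc with hf
  set q := (univ.filter fun j => c j ≠ 0).orderEmbOfFin hm.symm with hq
  have hdet := hA m f q f.strictMono q.strictMono
  have hmul : (A.submatrix f q).mulVec (c ∘ q) = 0 := by
    funext i
    have h1 : f i ∈ S := Finset.orderEmbOfFin_mem S hSc i
    have h2 : A.mulVec c (f i) = 0 := (Finset.mem_filter.mp (hS h1)).2
    rw [Pi.zero_apply, ← h2]
    simp only [Matrix.mulVec, dotProduct, Matrix.submatrix_apply, Function.comp]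
    have h3 : ∑ j, A (f i) j * c j = ∑ j ∈ univ.filter (fun j => c j ≠ 0), A (f i) j * c j := by
      symm
      apply Finset.sum_subset (Finset.subset_univ _)
      intro j _ hj
      have : c j = 0 := by simpa using hj
      simp [this]
    have h4 : (univ.filter (fun j => c j ≠ 0)) = Finset.univ.map q.toEmbedding := by
      rw [hq]; exact (Finset.map_orderEmbOfFin_univ _ _).symm
    rw [h3, h4, Finset.sum_map]
    rfl
  have h0 := Matrix.eq_zero_of_mulVec_eq_zero hdet hmul
  apply hc
  funext j
  by_contra hj
  have hj' : j ∈ (univ.filter fun j => c j ≠ 0) := by simpa using hj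
  have : j ∈ Set.range q := by
    rw [hq, Finset.range_orderEmbOfFin]; exact hj'
  obtain ⟨i, rfl⟩ := this
  exact hj (congrFun h0 i)

/-- The column relabelling. -/
def colMap {k δ : ℕ} (h : δ < k) : Fin k ⊕ Fin δ → Fin (k + δ) := Sum.elim
  (fun r => if hr : (r : ℕ) < δ then ⟨2 * r, by omega⟩ else ⟨r + δ, by omega⟩)
  (fun r => ⟨2 * r + 1, by omega⟩)

theorem colMap_inj {k δ : ℕ} (h : δ < k) : Function.Injective (colMap h) := by
  rintro (a | a) (b | b) hab
  · simp only [colMap, Sum.elim_inl] at hab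
    congr 1
    ext
    split_ifs at hab <;> simp only [Fin.mk.injEq] at hab <;> omega
  · simp only [colMap, Sum.elim_inl, Sum.elim_inr] at hab
    split_ifs at hab <;> simp only [Fin.mk.injEq] at hab <;> omega
  · simp only [colMap, Sum.elim_inl, Sum.elim_inr] at hab
    split_ifs at hab <;> simp only [Fin.mk.injEq] at hab <;> omega
  · simp only [colMap, Sum.elim_inr, Fin.mk.injEq] at hab
    congr 1
    ext
    omega

theorem B_weight {F : Type*} [Field F] [DecidableEq F] {n k δ : ℕ} (hδk : δ < k)
    (g : ℕ → ℕ → ℕ → F)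
    (𝒢 : Matrix (Fin n) (Fin (k + δ)) F)
    (h𝒢 : ∀ (x : Fin n) (c₀ : Fin (k + δ)),
      𝒢 x c₀ = if (c₀ : ℕ) < 2 * δ
        then g ((c₀ : ℕ) % 2) ((c₀ : ℕ) / 2) x
        else g 0 ((c₀ : ℕ) - δ) x)
    (hsup : Superregular 𝒢) (a : Fin k → F) (b : Fin δ → F) (h : a ≠ 0 ∨ b ≠ 0) :
    n + 1 ≤ (univ.filter fun x : Fin n =>
        (∑ r : Fin k, g 0 r x * a r) + (∑ r : Fin δ, g 1 r x * b r) ≠ 0).card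
      + ((univ.filter fun j => a j ≠ 0).card + (univ.filter fun j => b j ≠ 0).card) := by
  let e : Fin k ⊕ Fin δ ≃ Fin (k + δ) := Equiv.ofBijective (colMap hδk)
    ((Fintype.bijective_iff_injective_and_card _).mpr ⟨colMap_inj hδk, by simp⟩)
  have hel : ∀ (x : Fin n) (r : Fin k), 𝒢 x (e (Sum.inl r)) = g 0 r x := by
    intro x r
    show 𝒢 x (colMap hδk (Sum.inl r)) = _
    rw [h𝒢]
    simp only [colMap, Sum.elim_inl]
    by_cases hr : (r : ℕ) < δ
    · simp [hr]
    · have : ¬ ((r : ℕ) + δ < 2 * δ) := by omega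
      simp [hr, this]
  have her : ∀ (x : Fin n) (r : Fin δ), 𝒢 x (e (Sum.inr r)) = g 1 r x := by
    intro x r
    show 𝒢 x (colMap hδk (Sum.inr r)) = _
    rw [h𝒢]
    simp only [colMap, Sum.elim_inr]
    have h1 : 2 * (r : ℕ) + 1 < 2 * δ := by omega
    have h2 : (2 * (r : ℕ) + 1) % 2 = 1 := by omega
    have h3 : (2 * (r : ℕ) + 1) / 2 = r := by omega
    simp [h1, h2, h3]
  let c : Fin (k + δ) → F := fun j => Sum.elim a b (e.symm j)
  have hc : c ≠ 0 := by
    intro h0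
    rcases h with h | h
    · apply h; funext r
      have := congrFun h0 (e (Sum.inl r))
      simpa [c] using this
    · apply h; funext r
      have := congrFun h0 (e (Sum.inr r))
      simpa [c] using this
  have key := sr_weight 𝒢 hsup c hc
  have h1 : ∀ x, 𝒢.mulVec c x = (∑ r : Fin k, g 0 r x * a r) + (∑ r : Fin δ, g 1 r x * b r) := by
    intro x
    simp only [Matrix.mulVec, dotProduct]
    rw [← e.sum_comp, Fintype.sum_sum_type]
    simp [c, hel, her]
  have h2 : (univ.filter fun j => c j ≠ 0).card
      = (univ.filter fun j => a j ≠ 0).card + (univ.filter fun j => b j ≠ 0).card := by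
    simp only [Finset.card_filter]
    rw [← e.sum_comp, Fintype.sum_sum_type]
    simp [c]
  simp only [h1, h2] at key
  exact key

theorem polyWeight_ge {F : Type*} [Field F] [DecidableEq F] {n : ℕ} (v : Fin n → Polynomial F)
    (T : Finset ℕ) :
    ∑ i ∈ T, (univ.filter fun x => (v x).coeff i ≠ 0).card ≤ polyWeight v := by
  simp only [Finset.card_filter]
  rw [Finset.sum_comm]
  apply Finset.sum_le_sum
  intro x _
  rw [← Finset.card_filter]
  apply Finset.card_le_card
  intro i hi
  simpa using (Finset.mem_filter.mp hi).2

theorem coeff_prod_top {F : Type*} [Field F] {ι : Type*} (s : Finset ι) (p : ι → Polynomial F)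
    (d : ι → ℕ) (h : ∀ i ∈ s, (p i).natDegree ≤ d i) :
    (∏ i ∈ s, p i).natDegree ≤ ∑ i ∈ s, d i ∧
    (∏ i ∈ s, p i).coeff (∑ i ∈ s, d i) = ∏ i ∈ s, (p i).coeff (d i) := by
  classical
  induction s using Finset.induction_on with
  | empty => simp
  | insert a s ha ih =>
    obtain ⟨h1, h2⟩ := ih fun i hi => h i (Finset.mem_insert_of_mem hi)
    have h3 := h a (Finset.mem_insert_self _ _)
    rw [Finset.prod_insert ha, Finset.sum_insert ha, Finset.prod_insert ha]
    exact ⟨Polynomial.natDegree_mul_le_of_le h3 h1,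
      by rw [Polynomial.coeff_mul_add_eq_of_natDegree_le h3 h1, h2]⟩

theorem det_top {F : Type*} [Field F] {k : ℕ} (M : Matrix (Fin k) (Fin k) (Polynomial F))
    (d : Fin k → ℕ) (h : ∀ i j, (M i j).natDegree ≤ d j) :
    M.det.natDegree ≤ ∑ j, d j ∧
    M.det.coeff (∑ j, d j) = (Matrix.of fun i j => (M i j).coeff (d j)).det := by
  rw [Matrix.det_apply, Matrix.det_apply]
  constructor
  · apply Polynomial.natDegree_sum_le_of_forall_le
    intro σ _
    refine le_trans (Polynomial.natDegree_smul_le _ _) ?_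
    exact (coeff_prod_top univ (fun i => M (σ i) i) d (fun i _ => h _ _)).1
  · rw [Polynomial.finsetSum_coeff]
    apply Finset.sum_congr rfl
    intro σ _
    rw [Polynomial.coeff_smul, (coeff_prod_top univ (fun i => M (σ i) i) d (fun i _ => h _ _)).2]
    rfl

theorem coeff_G {F : Type*} [Field F] {n k δ : ℕ} (hδk : δ < k)
    (g : ℕ → ℕ → ℕ → F)
    (G : Matrix (Fin n) (Fin k) (Polynomial F))
    (hG : ∀ (x : Fin n) (r : Fin k),
      G x r = Polynomial.C (g 0 r x) +
        (if (r : ℕ) < δ then Polynomial.C (g 1 r x) else 0) * Polynomial.X)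
    (u : Fin k → Polynomial F) (x : Fin n) (i : ℕ) :
    (G.mulVec u x).coeff i = (∑ r : Fin k, g 0 r x * (u r).coeff i)
      + ∑ r : Fin δ, g 1 r x * (X * u (Fin.castLE hδk.le r)).coeff i := by
  simp only [Matrix.mulVec, dotProduct, Polynomial.finsetSum_coeff, hG]
  have : ∀ r : Fin k, ((Polynomial.C (g 0 r x) +
        (if (r : ℕ) < δ then Polynomial.C (g 1 r x) else 0) * Polynomial.X) * u r).coeff i
      = g 0 r x * (u r).coeff i
        + (if (r : ℕ) < δ then g 1 r x * (X * u r).coeff i else 0) := by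
    intro r
    split_ifs
    · rw [add_mul, mul_assoc, Polynomial.coeff_add, Polynomial.coeff_C_mul, Polynomial.coeff_C_mul]
    · simp
  simp only [this, Finset.sum_add_distrib]
  congr 1
  rw [← Finset.sum_filter]
  symm
  apply Finset.sum_bij (fun (r : Fin δ) _ => Fin.castLE hδk.le r)
  · intro a _; simp
  · intro a _ b _ hab; simpa using hab
  · intro b hb
    exact ⟨⟨b, (Finset.mem_filter.mp hb).2⟩, by simp, by ext; simp⟩
  · intro a _; simp

theorem lower {F : Type*} [Field F] {n k δ : ℕ} (hδk : δ < k) (hkn : k < n)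
    (hn : n ≥ δ + k - 1) (g : ℕ → ℕ → ℕ → F)
    (G : Matrix (Fin n) (Fin k) (Polynomial F))
    (hG : ∀ (x : Fin n) (r : Fin k),
      G x r = Polynomial.C (g 0 r x) +
        (if (r : ℕ) < δ then Polynomial.C (g 1 r x) else 0) * Polynomial.X)
    (𝒢 : Matrix (Fin n) (Fin (k + δ)) F)
    (h𝒢 : ∀ (x : Fin n) (c₀ : Fin (k + δ)),
      𝒢 x c₀ = if (c₀ : ℕ) < 2 * δ
        then g ((c₀ : ℕ) % 2) ((c₀ : ℕ) / 2) x
        else g 0 ((c₀ : ℕ) - δ) x)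
    (hsup : Superregular 𝒢) (u : Fin k → Polynomial F) (hu : u ≠ 0) :
    n - k + δ + 1 ≤ polyWeight (G.mulVec u) := by
  classical
  have hW : ∀ i, ((fun r => (u r).coeff i) ≠ 0 ∨
      (fun r : Fin δ => (X * u (Fin.castLE hδk.le r)).coeff i) ≠ 0) →
      n + 1 ≤ (univ.filter fun x => (G.mulVec u x).coeff i ≠ 0).card
      + ((univ.filter fun r => (u r).coeff i ≠ 0).card
        + (univ.filter fun r : Fin δ => (X * u (Fin.castLE hδk.le r)).coeff i ≠ 0).card) := by
    intro i hi
    simp only [coeff_G hδk g G hG u]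
    exact B_weight hδk g 𝒢 h𝒢 hsup _ _ hi
  have hak : ∀ i, (univ.filter fun r => (u r).coeff i ≠ 0).card ≤ k := by
    intro i; simpa using Finset.card_filter_le (univ : Finset (Fin k)) fun r => (u r).coeff i ≠ 0
  have hbδ : ∀ i, (univ.filter fun r : Fin δ =>
      (X * u (Fin.castLE hδk.le r)).coeff i ≠ 0).card ≤ δ := by
    intro i
    simpa using Finset.card_filter_le (univ : Finset (Fin δ))
      fun r => (X * u (Fin.castLE hδk.le r)).coeff i ≠ 0
  -- the set of active times
  let S : Finset ℕ := univ.biUnion fun r => (u r).support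
  have hSmem : ∀ i, i ∈ S ↔ ∃ r, (u r).coeff i ≠ 0 := by
    intro i; simp [S]
  have hSne : S.Nonempty := by
    obtain ⟨r, hr⟩ := Function.ne_iff.mp hu
    obtain ⟨i, hi⟩ := Polynomial.support_nonempty.mpr hr
    exact ⟨i, (hSmem i).2 ⟨r, by simpa using hi⟩⟩
  obtain ⟨d, hd, hdmax⟩ : ∃ d ∈ S, ∀ i ∈ S, i ≤ d :=
    ⟨S.max' hSne, S.max'_mem hSne, fun i hi => S.le_max' i hi⟩
  obtain ⟨e, he, hemin⟩ : ∃ e ∈ S, ∀ i ∈ S, e ≤ i :=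
    ⟨S.min' hSne, S.min'_mem hSne, fun i hi => S.min'_le i hi⟩
  have hzero : ∀ i, i ∉ S → ∀ r, (u r).coeff i = 0 := by
    intro i hi r; by_contra h; exact hi ((hSmem i).2 ⟨r, h⟩)
  have hane : ∀ i ∈ S, (fun r => (u r).coeff i) ≠ 0 := by
    intro i hi
    obtain ⟨r, hr⟩ := (hSmem i).1 hi
    exact fun h => hr (congrFun h r)
  -- time e
  have hbe : (univ.filter fun r : Fin δ =>
      (X * u (Fin.castLE hδk.le r)).coeff e ≠ 0).card = 0 := by
    rw [Finset.card_eq_zero, Finset.filter_eq_empty_iff]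
    intro r _
    rw [not_not]
    cases e with
    | zero => simp
    | succ m =>
      rw [Polynomial.coeff_X_mul]
      exact hzero m (fun h => by have := hemin m h; omega) _
  have hWe := hW e (Or.inl (hane e he))
  have hke := hak e
  by_cases hcase : ∃ r : Fin δ, (u (Fin.castLE hδk.le r)).coeff d ≠ 0
  · obtain ⟨r, hr⟩ := hcase
    have hWd := hW (d + 1) (Or.inr fun h => hr (by
      have := congrFun h r
      simpa [Polynomial.coeff_X_mul] using this))
    have had : (univ.filter fun r => (u r).coeff (d + 1) ≠ 0).card = 0 := by
      rw [Finset.card_eq_zero, Finset.filter_eq_empty_iff]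
      intro r _
      rw [not_not]
      exact hzero _ (fun h => by have := hdmax _ h; omega) _
    have hb := hbδ (d + 1)
    have hed : e ≠ d + 1 := by have := hemin d hd; omega
    have hT := polyWeight_ge (G.mulVec u) {e, d + 1}
    rw [Finset.sum_pair hed] at hT
    omega
  · push Not at hcase
    have had : (univ.filter fun r => (u r).coeff d ≠ 0).card + δ ≤ k := by
      have h1 : (univ.filter fun r => (u r).coeff d ≠ 0) ⊆
          (univ.image (Fin.castLE hδk.le))ᶜ := by
        intro r hr
        rw [Finset.mem_compl]
        intro hr2
        obtain ⟨s, _, rfl⟩ := Finset.mem_image.mp hr2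
        exact (Finset.mem_filter.mp hr).2 (hcase s)
      have h2 := Finset.card_le_card h1
      rw [Finset.card_compl, Finset.card_image_of_injective _ (Fin.castLE_injective hδk.le)] at h2
      simp only [Fintype.card_fin, Finset.card_univ] at h2
      omega
    by_cases hed : e = d
    · subst hed
      have hT := polyWeight_ge (G.mulVec u) {e}
      rw [Finset.sum_singleton] at hT
      omega
    · have hWd := hW d (Or.inl (hane d hd))
      have hb := hbδ d
      have hT := polyWeight_ge (G.mulVec u) {e, d}
      rw [Finset.sum_pair hed] at hT
      omega

theorem upper {F : Type*} [Field F] {n k δ : ℕ} (hδk : δ < k) (hkn : k < n)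
    (g : ℕ → ℕ → ℕ → F)
    (G : Matrix (Fin n) (Fin k) (Polynomial F))
    (hG : ∀ (x : Fin n) (r : Fin k),
      G x r = Polynomial.C (g 0 r x) +
        (if (r : ℕ) < δ then Polynomial.C (g 1 r x) else 0) * Polynomial.X) :
    ∃ u : Fin k → Polynomial F, u ≠ 0 ∧ polyWeight (G.mulVec u) ≤ n - k + δ + 1 := by
  classical
  let M : Matrix (Fin (k - 1)) (Fin k) F := fun j r =>
    if (j : ℕ) < δ then (if (r : ℕ) = j then 1 else 0) else g 0 r (j - δ)
  have hker : LinearMap.ker M.mulVecLin ≠ ⊥ := by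
    apply LinearMap.ker_ne_bot_of_finrank_lt
    simp; omega
  obtain ⟨w, hw, hw0⟩ := (Submodule.ne_bot_iff _).mp hker
  have hw' : M.mulVec w = 0 := by simpa using hw
  have hw1 : ∀ r : Fin k, (r : ℕ) < δ → w r = 0 := by
    intro r hr
    have := congrFun hw' ⟨r, by omega⟩
    simp only [Matrix.mulVec, dotProduct, M, hr, if_true, Pi.zero_apply, ite_mul, one_mul,
      zero_mul] at this
    simpa [Fin.val_inj] using this
  have hw2 : ∀ x : ℕ, x + δ < k - 1 → ∑ r : Fin k, g 0 r x * w r = 0 := by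
    intro x hx
    have := congrFun hw' ⟨x + δ, hx⟩
    simpa [Matrix.mulVec, dotProduct, M] using this
  have hv : ∀ x, G.mulVec (fun r => C (w r)) x = C (∑ r : Fin k, g 0 r x * w r) := by
    intro x
    simp only [Matrix.mulVec, dotProduct, map_sum]
    apply Finset.sum_congr rfl
    intro r _
    rw [hG]
    by_cases hr : (r : ℕ) < δ
    · simp [hw1 r hr]
    · simp [hr]
  refine ⟨fun r => C (w r), ?_, ?_⟩
  · intro h
    apply hw0
    funext r
    simpa using congrFun h r
  · have hb : ∀ x : Fin n, (G.mulVec (fun r => C (w r)) x).support.card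
        ≤ if (x : ℕ) + δ < k - 1 then 0 else 1 := by
      intro x
      rw [hv]
      split_ifs with hx
      · rw [hw2 x hx]; simp
      · exact (Finset.card_le_card (Polynomial.support_C_subset _)).trans (by simp)
    refine le_trans (Finset.sum_le_sum fun x _ => hb x) ?_
    rw [Fin.sum_univ_eq_sum_range (fun x => if x + δ < k - 1 then 0 else 1) n]
    have : n = (k - 1 - δ) + (n - (k - 1 - δ)) := by omega
    rw [this, Finset.sum_range_add]
    have h1 : ∑ x ∈ Finset.range (k - 1 - δ), (if x + δ < k - 1 then 0 else 1) = 0 := by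
      apply Finset.sum_eq_zero
      intro x hx
      have := Finset.mem_range.mp hx
      rw [if_pos (by omega)]
    rw [h1]
    have h2 : ∑ x ∈ Finset.range (n - (k - 1 - δ)),
        (if (k - 1 - δ) + x + δ < k - 1 then 0 else 1) ≤ n - (k - 1 - δ) := by
      refine le_trans (Finset.sum_le_card_nsmul _ _ 1 fun x _ => ?_) (by simp)
      split_ifs <;> omega
    omega


/-- Case `δ < k` (so `ν = 1`, `t = δ`): if the coefficient matrix `𝒢` is superregular and
`n ≥ δ + k - 1`, then `G(z) = G₀ + G₁ z` (with only the first `δ` columns of `G₁` nonzero)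
generates an MDS convolutional code of rate `k/n` and degree `δ`, i.e. its free distance is
`n - k + δ + 1`. -/
theorem mds_convolutional_small_delta {F : Type*} [Field F] [Fintype F]
    {n k δ : ℕ} (hδ : 0 < δ) (hδk : δ < k) (hkn : k < n)
    (hn : n ≥ δ + k - 1)
    (g : ℕ → ℕ → ℕ → F)
    (G : Matrix (Fin n) (Fin k) (Polynomial F))
    (hG : ∀ (x : Fin n) (r : Fin k),
      G x r = Polynomial.C (g 0 r x) +
        (if (r : ℕ) < δ then Polynomial.C (g 1 r x) else 0) * Polynomial.X)
    (𝒢 : Matrix (Fin n) (Fin (k + δ)) F)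
    (h𝒢 : ∀ (x : Fin n) (c₀ : Fin (k + δ)),
      𝒢 x c₀ = if (c₀ : ℕ) < 2 * δ
        then g ((c₀ : ℕ) % 2) ((c₀ : ℕ) / 2) x
        else g 0 ((c₀ : ℕ) - δ) x)
    (hsup : Superregular 𝒢) :
    (∀ u : Fin k → Polynomial F, G.mulVec u = 0 → u = 0)
    ∧ maxMinorDeg G = δ
    ∧ freeDist G = n - k + δ + 1 := by
  have hlow := lower hδk hkn hn g G hG 𝒢 h𝒢 hsup
  refine ⟨?_, ?_, ?_⟩
  · intro u h0
    by_contra hu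
    have := hlow u hu
    rw [h0] at this
    simp [polyWeight] at this
  · let d : Fin k → ℕ := fun r => if (r : ℕ) < δ then 1 else 0
    have hd : ∑ r, d r = δ := by
      simp only [d]
      rw [Fin.sum_univ_eq_sum_range (fun r => if r < δ then 1 else 0) k, ← Finset.card_filter]
      have : (Finset.range k).filter (fun r => r < δ) = Finset.range δ := by
        ext r; simp; omega
      rw [this, Finset.card_range]
    have hdeg : ∀ x r, (G x r).natDegree ≤ d r := by
      intro x r
      rw [hG]
      simp only [d]
      split_ifs
      · compute_degree
      · simp
    apply le_antisymm
    · apply Finset.sup_le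
      intro f _
      have := (det_top (G.submatrix f id) d (fun i j => hdeg _ _)).1
      omega
    · have h1 := (det_top (G.submatrix (Fin.castLE hkn.le) id) d (fun i j => hdeg _ _)).2
      rw [hd] at h1
      let q : Fin k → Fin (k + δ) := fun r =>
        if hr : (r : ℕ) < δ then ⟨2 * r + 1, by omega⟩ else ⟨r + δ, by omega⟩
      have hq : StrictMono q := by
        intro a b hab
        have hab' : (a : ℕ) < b := hab
        simp only [q]
        split_ifs <;> simp only [Fin.mk_lt_mk] <;> omega
      have h2 := hsup k (Fin.castLE hkn.le) q (Fin.strictMono_castLE hkn.le) hq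
      have h3 : (Matrix.of fun i j =>
          (G.submatrix (Fin.castLE hkn.le) id i j).coeff (d j))
          = 𝒢.submatrix (Fin.castLE hkn.le) q := by
        ext i j
        simp only [Matrix.of_apply, Matrix.submatrix_apply, id]
        rw [hG, h𝒢]
        by_cases hj : (j : ℕ) < δ
        · have e1 : 2 * (j : ℕ) + 1 < 2 * δ := by omega
          have e2 : (2 * (j : ℕ) + 1) % 2 = 1 := by omega
          have e3 : (2 * (j : ℕ) + 1) / 2 = j := by omega
          simp [q, d, hj, e1, e2, e3, Polynomial.coeff_C]
        · have e1 : ¬ ((j : ℕ) + δ < 2 * δ) := by omega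
          simp [q, d, hj, e1]
      rw [h3] at h1
      rw [← h1] at h2
      exact le_trans (Polynomial.le_natDegree_of_ne_zero h2)
        (Finset.le_sup (f := fun f : Fin k → Fin n => ((G.submatrix f id).det).natDegree)
          (Finset.mem_univ (Fin.castLE hkn.le)))
  · obtain ⟨u, hu, hup⟩ := upper hδk hkn g G hG
    have hGu : G.mulVec u ≠ 0 := by
      intro h0
      have := hlow u hu
      rw [h0] at this
      simp [polyWeight] at this
    apply le_antisymm
    · exact le_trans (Nat.sInf_le ⟨u, hGu, rfl⟩) hup
    · refine le_csInf (s := {w : ℕ | ∃ u : Fin k → Polynomial F,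
        G.mulVec u ≠ 0 ∧ w = polyWeight (G.mulVec u)}) ⟨_, u, hGu, rfl⟩ ?_
      rintro w ⟨u', hu', rfl⟩
      apply hlow
      rintro rfl
      exact hu' (Matrix.mulVec_zero _)
end

section
/- Let n, k, δ be positive integers with δ < k < n and n ≥ k + δ − 1. Let F be a finite field with |F| = q, q odd, q ≥ 2·max{k+δ, n} + 1, let α ∈ F have multiplicative order (q−1)/2, let b ∈ F be a nonsquare, and let C = [c_{ij}] with c_{ij} = 1/(1 − b·α^{j−i}) for 0 ≤ i, j ≤ (q−3)/2. Let 𝒢 ∈ F^{n×(k+δ)} be the submatrix of C consisting of rows 0,…,n−1 and columns 0,…,k+δ−1, write its columns in order as g_{0,1}, g_{1,1}, …, g_{0,δ}, g_{1,δ}, g_{0,δ+1}, …, g_{0,k}, and set G(z) = G_0 + G_1 z ∈ F[z]^{n×k} where G_i = [g_{i,1} … g_{i,k}] (with g_{1,r} = 0 for r > δ). Then G(z) is the generator matrix of an MDS convolutional code of rate k/n and degree δ over F, i.e., Im_{F[z]} G(z) has degree δ and free distance n − k + δ + 1. -/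
open Matrix Polynomial Finset

lemma cauchy_aux {F ι : Type*} [Field F] [DecidableEq ι] (S : Finset ι) (w y : ι → F)
    (hy : Set.InjOn y S) (T : Finset F) (hT : ∀ t ∈ T, ∀ j ∈ S, t ≠ y j)
    (hw : ∃ j ∈ S, w j ≠ 0) (h0 : ∀ t ∈ T, ∑ j ∈ S, w j * (t - y j)⁻¹ = 0) :
    T.card < S.card := by
  classical
  obtain ⟨j0, hj0, hw0⟩ := hw
  set P : F[X] := ∑ j ∈ S, C (w j) * ∏ l ∈ S.erase j, (X - C (y l)) with hP
  have hPe : P.eval (y j0) ≠ 0 := by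
    rw [hP, eval_finsetSum, Finset.sum_eq_single j0]
    · simp only [eval_mul, eval_C, eval_prod, eval_sub, eval_X]
      refine mul_ne_zero hw0 (Finset.prod_ne_zero_iff.2 fun l hl => ?_)
      rw [Finset.mem_erase] at hl
      exact sub_ne_zero.2 fun h => hl.1 (hy hl.2 hj0 h.symm)
    · intro j hj hne
      simp only [eval_mul, eval_C, eval_prod, eval_sub, eval_X]
      rw [Finset.prod_eq_zero (i := j0) (Finset.mem_erase.2 ⟨hne.symm, hj0⟩) (sub_self _), mul_zero]
    · exact fun h => absurd hj0 h
  have hP0 : P ≠ 0 := by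
    rintro h
    rw [h] at hPe
    simp at hPe
  have hdeg : P.natDegree ≤ S.card - 1 := by
    refine natDegree_sum_le_of_forall_le _ _ fun j hj => ?_
    refine (natDegree_C_mul_le _ _).trans ?_
    rw [natDegree_finsetProd_X_sub_C_eq_card, Finset.card_erase_of_mem hj]
  have hroot : T ⊆ P.roots.toFinset := by
    intro t ht
    rw [Multiset.mem_toFinset, mem_roots hP0, IsRoot.def]
    have h1 := h0 t ht
    have h2 : P.eval t = (∏ l ∈ S, (t - y l)) * ∑ j ∈ S, w j * (t - y j)⁻¹ := by
      rw [hP, eval_finsetSum, Finset.mul_sum]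
      refine Finset.sum_congr rfl fun j hj => ?_
      simp only [eval_mul, eval_C, eval_prod, eval_sub, eval_X]
      rw [← Finset.mul_prod_erase S _ hj]
      have := sub_ne_zero.2 (hT t ht j hj)
      field_simp
    rw [h2, h1, mul_zero]
  have h3 : T.card ≤ P.natDegree :=
    (Finset.card_le_card hroot).trans ((Multiset.toFinset_card_le _).trans (card_roots' P))
  have h4 : 0 < S.card := Finset.card_pos.2 ⟨j0, hj0⟩
  omega

lemma circ_aux {F : Type*} [Field F] [Fintype F]
    {q : ℕ} (hq : Fintype.card F = q) (hodd : Odd q)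
    (α : F) (hα : orderOf α = (q - 1) / 2)
    (b : F) (hb : ¬ IsSquare b)
    (c : ℕ → ℕ → F)
    (hc : ∀ i j, c i j = (1 - b * α ^ ((j : ℤ) - (i : ℤ)))⁻¹)
    {ι : Type*} [DecidableEq ι] (S : Finset ι) (e : ι → ℕ) (he : Set.InjOn e S)
    (heq : ∀ j ∈ S, e j < (q - 1) / 2) (T : Finset ℕ) (hT : ∀ t ∈ T, t < (q - 1) / 2)
    (w : ι → F) (hw : ∃ j ∈ S, w j ≠ 0) (h0 : ∀ t ∈ T, ∑ j ∈ S, w j * c t (e j) = 0) :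
    T.card < S.card := by
  have hb0 : b ≠ 0 := by rintro rfl; exact hb (by simp)
  have hpos : 0 < (q - 1) / 2 := by
    obtain ⟨j, hj, _⟩ := hw
    exact (Nat.zero_le _).trans_lt (heq j hj)
  have hα1 : α ^ ((q - 1) / 2) = 1 := by rw [← hα]; exact pow_orderOf_eq_one α
  have hα0 : α ≠ 0 := by
    rintro rfl
    rw [zero_pow hpos.ne'] at hα1
    exact zero_ne_one hα1
  have hchar : ringChar F ≠ 2 := by
    intro h
    have := FiniteField.even_card_iff_char_two.1 h
    rw [hq] at this
    obtain ⟨m, rfl⟩ := hodd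
    omega
  have hsq : IsSquare α := by
    rw [FiniteField.isSquare_iff hchar hα0, hq]
    rw [show q / 2 = (q - 1) / 2 by obtain ⟨m, rfl⟩ := hodd; omega]
    exact hα1
  have hinj : ∀ i j : ℕ, i < (q - 1) / 2 → j < (q - 1) / 2 → α ^ i = α ^ j → i = j := by
    intro i j hi hj h
    rw [← hα] at hi hj
    exact pow_injOn_Iio_orderOf hi hj h
  have hne : ∀ i j : ℕ, α ^ i ≠ b * α ^ j := by
    intro i j h
    apply hb
    have : b = α ^ i / α ^ j := by
      rw [h, mul_div_assoc, div_self (pow_ne_zero _ hα0), mul_one]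
    rw [this]
    exact (hsq.pow i).div (hsq.pow j)
  classical
  have key := cauchy_aux S w (fun j => b * α ^ (e j)) ?_ (T.image fun t => α ^ t) ?_ hw ?_
  · rwa [Finset.card_image_of_injOn] at key
    intro i hi j hj h
    exact hinj i j (hT i hi) (hT j hj) h
  · intro i hi j hj h
    exact he hi hj (hinj _ _ (heq i hi) (heq j hj) (mul_left_cancel₀ hb0 h))
  · intro t ht j hj
    obtain ⟨i, hi, rfl⟩ := Finset.mem_image.1 ht
    exact hne _ _
  · intro t ht
    obtain ⟨i, hi, rfl⟩ := Finset.mem_image.1 ht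
    have h1 := h0 i hi
    have h2 : ∑ j ∈ S, w j * c i (e j) = α ^ i * ∑ j ∈ S, w j * (α ^ i - b * α ^ (e j))⁻¹ := by
      rw [Finset.mul_sum]
      refine Finset.sum_congr rfl fun j hj => ?_
      have h3 : α ^ i ≠ 0 := pow_ne_zero _ hα0
      have h4 : 1 - b * α ^ ((e j : ℤ) - (i : ℤ)) = (α ^ i - b * α ^ (e j)) * (α ^ i)⁻¹ := by
        rw [zpow_sub₀ hα0, zpow_natCast, zpow_natCast]
        field_simp
      rw [hc, h4, mul_inv, inv_inv]
      ring
    rw [h2] at h1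
    exact (mul_eq_zero.1 h1).resolve_left (pow_ne_zero _ hα0)

lemma coeff_prod_aux {R ι : Type*} [CommSemiring R] (s : Finset ι) (p : ι → R[X]) (d : ι → ℕ)
    (h : ∀ i ∈ s, (p i).natDegree ≤ d i) :
    (∏ i ∈ s, p i).coeff (∑ i ∈ s, d i) = ∏ i ∈ s, (p i).coeff (d i) := by
  classical
  induction s using Finset.induction_on with
  | empty => simp
  | insert a s ha ih =>
    have h1 : ∀ i ∈ s, (p i).natDegree ≤ d i := fun i hi => h i (Finset.mem_insert_of_mem hi)
    rw [Finset.prod_insert ha, Finset.sum_insert ha, Finset.prod_insert ha,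
      coeff_mul_add_eq_of_natDegree_le (h a (Finset.mem_insert_self _ _)), ih h1]
    exact (natDegree_prod_le _ _).trans (Finset.sum_le_sum h1)

lemma det_deg_aux {R : Type*} [CommRing R] {k : ℕ} (M : Matrix (Fin k) (Fin k) R[X]) (d : Fin k → ℕ)
    (h : ∀ i j, (M i j).natDegree ≤ d j) :
    M.det.natDegree ≤ ∑ j, d j ∧
      M.det.coeff (∑ j, d j) = (Matrix.of fun i j => (M i j).coeff (d j)).det := by
  constructor
  · rw [Matrix.det_apply]
    refine natDegree_sum_le_of_forall_le _ _ fun σ _ => ?_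
    refine (natDegree_smul_le _ _).trans ?_
    exact (natDegree_prod_le _ _).trans (Finset.sum_le_sum fun j _ => h _ _)
  · rw [Matrix.det_apply, Matrix.det_apply, finsetSum_coeff]
    refine Finset.sum_congr rfl fun σ _ => ?_
    rw [Units.smul_def, Units.smul_def, coeff_smul,
      coeff_prod_aux _ _ _ (fun i _ => h (σ i) i)]
    rfl

lemma polyWeight_one {F : Type*} [Field F] [DecidableEq F] {n : ℕ} (v : Fin n → F[X]) (i : ℕ) :
    (univ.filter fun x => (v x).coeff i ≠ 0).card ≤ polyWeight v := by
  rw [Finset.card_filter]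
  refine Finset.sum_le_sum fun x _ => ?_
  split_ifs with h
  · exact Finset.card_pos.2 ⟨i, mem_support_iff.2 h⟩
  · exact Nat.zero_le _

lemma polyWeight_two {F : Type*} [Field F] [DecidableEq F] {n : ℕ} (v : Fin n → F[X]) (i j : ℕ) (hij : i ≠ j) :
    (univ.filter fun x => (v x).coeff i ≠ 0).card + (univ.filter fun x => (v x).coeff j ≠ 0).card
      ≤ polyWeight v := by
  classical
  rw [Finset.card_filter, Finset.card_filter, ← Finset.sum_add_distrib]
  refine Finset.sum_le_sum fun x _ => ?_
  have : (({i, j} : Finset ℕ).filter fun l => (v x).coeff l ≠ 0).card ≤ (v x).support.card := by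
    refine Finset.card_le_card fun l hl => ?_
    exact mem_support_iff.2 (Finset.mem_filter.1 hl).2
  rwa [Finset.card_filter, Finset.sum_pair hij] at this

/-- Construction 1 for `δ < k`: taking the coefficient vectors of `G(z) = G₀ + G₁ z` as the
suitably arranged columns of the first `n` rows and first `k + δ` columns of the Cauchy
circulant matrix `c_{ij} = 1/(1 - b α^{j-i})` yields a generator matrix of an MDS
convolutional code of rate `k/n` and degree `δ`, i.e. the code generated by `G(z)` has
degree `δ` and free distance `n - k + δ + 1`. -/
theorem construction1_small_delta {F : Type*} [Field F] [Fintype F]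
    {n k δ q : ℕ} (hδ : 0 < δ) (hδk : δ < k) (hkn : k < n)
    (hn : n ≥ k + δ - 1)
    (hq : Fintype.card F = q) (hodd : Odd q)
    (hqsize : q ≥ 2 * max (k + δ) n + 1)
    (α : F) (hα : orderOf α = (q - 1) / 2)
    (b : F) (hb : ¬ IsSquare b)
    (c : ℕ → ℕ → F)
    (hc : ∀ i j, c i j = (1 - b * α ^ ((j : ℤ) - (i : ℤ)))⁻¹)
    (G : Matrix (Fin n) (Fin k) (Polynomial F))
    (hG : ∀ (x : Fin n) (r : Fin k),
      G x r = Polynomial.C (c x (if (r : ℕ) < δ then 2 * (r : ℕ) else δ + (r : ℕ))) +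
        (if (r : ℕ) < δ then Polynomial.C (c x (2 * (r : ℕ) + 1)) else 0) * Polynomial.X) :
    (∀ u : Fin k → Polynomial F, G.mulVec u = 0 → u = 0)
    ∧ maxMinorDeg G = δ
    ∧ freeDist G = n - k + δ + 1 := by
  classical
  have hkδ : k + δ ≤ (q - 1) / 2 := by have := le_max_left (k + δ) n; omega
  have hnq : n ≤ (q - 1) / 2 := by have := le_max_right (k + δ) n; omega
  set e0 : Fin k → ℕ := fun r => if (r : ℕ) < δ then 2 * (r : ℕ) else δ + (r : ℕ) with he0
  -- weight of combinations of columns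
  have W : ∀ (A B : Finset (Fin k)) (p p' : Fin k → F), (∀ r ∈ B, (r : ℕ) < δ) →
      ((∃ r ∈ A, p r ≠ 0) ∨ (∃ r ∈ B, p' r ≠ 0)) →
      n + 1 ≤ (univ.filter fun x : Fin n =>
        ∑ r ∈ A, p r * c x (e0 r) + ∑ r ∈ B, p' r * c x (2 * (r : ℕ) + 1) ≠ 0).card
        + (A.card + B.card) := by
    intro A B p p' hB hne
    have key := circ_aux hq hodd α hα b hb c hc (A.disjSum B)
      (Sum.elim e0 fun r => 2 * (r : ℕ) + 1) ?_ ?_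
      ((univ.filter fun x : Fin n => ∑ r ∈ A, p r * c x (e0 r)
        + ∑ r ∈ B, p' r * c x (2 * (r : ℕ) + 1) = 0).image Fin.val) ?_ (Sum.elim p p') ?_ ?_
    · rw [Finset.card_image_of_injective _ Fin.val_injective, Finset.card_disjSum] at key
      have := Finset.card_filter_add_card_filter_not (s := (univ : Finset (Fin n)))
        (fun x : Fin n => ∑ r ∈ A, p r * c x (e0 r)
        + ∑ r ∈ B, p' r * c x (2 * (r : ℕ) + 1) = 0)
      rw [Finset.card_univ, Fintype.card_fin] at this
      simp only [ne_eq]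
      omega
    · rintro (i | i) hi (j | j) hj h
      · simp only [Sum.elim_inl, he0] at h
        congr 1
        apply Fin.ext
        split_ifs at h <;> omega
      · have hj' := hB j (by simpa using hj)
        simp only [Sum.elim_inl, Sum.elim_inr, he0] at h
        split_ifs at h <;> omega
      · have hj' := hB i (by simpa using hi)
        simp only [Sum.elim_inl, Sum.elim_inr, he0] at h
        split_ifs at h <;> omega
      · simp only [Sum.elim_inr] at h
        congr 1
        apply Fin.ext
        omega
    · rintro (i | i) hi
      · simp only [Sum.elim_inl, he0]
        split_ifs <;> omega
      · have hj' := hB i (by simpa using hi)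
        simp only [Sum.elim_inr]
        omega
    · intro t ht
      obtain ⟨x, _, rfl⟩ := Finset.mem_image.1 ht
      omega
    · rcases hne with ⟨r, hr, h⟩ | ⟨r, hr, h⟩
      · exact ⟨Sum.inl r, by simpa using hr, h⟩
      · exact ⟨Sum.inr r, by simpa using hr, h⟩
    · intro t ht
      obtain ⟨x, hx, rfl⟩ := Finset.mem_image.1 ht
      rw [Finset.sum_disjSum]
      exact (Finset.mem_filter.1 hx).2
  set L : Finset (Fin k) := univ.filter fun r => (r : ℕ) < δ with hL
  set R : Finset (Fin k) := univ.filter fun r => ¬ (r : ℕ) < δ with hR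
  have hLc : L.card = δ := by
    rw [hL, Fin.card_filter_val_lt]
    exact min_eq_right hδk.le
  have hLR : L.card + R.card = k := by
    have := Finset.card_filter_add_card_filter_not (s := (univ : Finset (Fin k)))
      (fun r : Fin k => (r : ℕ) < δ)
    rwa [Finset.card_univ, Fintype.card_fin] at this
  have hRc : R.card = k - δ := by omega
  -- coefficients of codewords
  have hco : ∀ (u : Fin k → F[X]) (x : Fin n) (i : ℕ), (G.mulVec u x).coeff i =
      ∑ r, (u r).coeff i * c x (e0 r) + ∑ r ∈ L, (X * u r).coeff i * c x (2 * (r : ℕ) + 1) := by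
    intro u x i
    rw [hL, Finset.sum_filter, ← Finset.sum_add_distrib, Matrix.mulVec, dotProduct, finsetSum_coeff]
    refine Finset.sum_congr rfl fun r _ => ?_
    rw [hG, add_mul, coeff_add, coeff_C_mul, mul_comm]
    congr 1
    split_ifs
    · rw [mul_assoc, coeff_C_mul, mul_comm]
    · simp
  have hW2 : ∀ (u : Fin k → F[X]) (i : ℕ) (A B : Finset (Fin k)), B ⊆ L →
      (∀ r, r ∉ A → (u r).coeff i = 0) → (∀ r ∈ L, r ∉ B → (X * u r).coeff i = 0) →
      ((∃ r ∈ A, (u r).coeff i ≠ 0) ∨ (∃ r ∈ B, (X * u r).coeff i ≠ 0)) →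
      n + 1 ≤ (univ.filter fun x : Fin n => (G.mulVec u x).coeff i ≠ 0).card
        + (A.card + B.card) := by
    intro u i A B hBL hA hB hne
    have := W A B (fun r => (u r).coeff i) (fun r => (X * u r).coeff i)
      (fun r hr => (Finset.mem_filter.1 (hBL hr)).2) hne
    convert this using 5 with x
    rw [hco]
    congr 1
    · refine (Finset.sum_subset (Finset.subset_univ A) fun r _ hr => ?_).symm
      rw [hA r hr, zero_mul]
    · refine (Finset.sum_subset hBL fun r hr hr' => ?_).symm
      rw [hB r hr hr', zero_mul]
  -- lower bound on the weight
  have hlow : ∀ u : Fin k → F[X], u ≠ 0 → n - k + δ + 1 ≤ polyWeight (G.mulVec u) := by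
    intro u hu
    set S : Finset ℕ := univ.biUnion fun r => (u r).support with hS
    have hmem : ∀ i, i ∈ S ↔ ∃ r, (u r).coeff i ≠ 0 := by
      intro i
      simp [hS]
    have hSne : S.Nonempty := by
      obtain ⟨r, hr⟩ := Function.ne_iff.1 hu
      obtain ⟨i, hi⟩ := support_nonempty.2 hr
      exact ⟨i, (hmem i).2 ⟨r, mem_support_iff.1 hi⟩⟩
    obtain ⟨m, hm, hmin⟩ : ∃ m ∈ S, ∀ i ∈ S, m ≤ i :=
      ⟨S.min' hSne, S.min'_mem hSne, fun i hi => S.min'_le i hi⟩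
    obtain ⟨d, hd, hmax⟩ : ∃ d ∈ S, ∀ i ∈ S, i ≤ d :=
      ⟨S.max' hSne, S.max'_mem hSne, fun i hi => S.le_max' i hi⟩
    have hprev : ∀ r, (X * u r).coeff m = 0 := by
      intro r
      rcases m with _ | m
      · simp
      · rw [coeff_X_mul]
        by_contra h
        have := hmin m ((hmem m).2 ⟨r, h⟩)
        omega
    have hm1 := hW2 u m univ ∅ (Finset.empty_subset _) (fun r hr => absurd (Finset.mem_univ r) hr)
      (fun r _ _ => hprev r)
      (Or.inl (by obtain ⟨r, hr⟩ := (hmem m).1 hm; exact ⟨r, Finset.mem_univ r, hr⟩))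
    rw [Finset.card_univ, Fintype.card_fin, Finset.card_empty] at hm1
    by_cases hcase : ∃ r ∈ L, (u r).coeff d ≠ 0
    · have hd1 := hW2 u (d + 1) ∅ L (Finset.Subset.refl _) (fun r _ => by
          by_contra h
          have := hmax (d + 1) ((hmem _).2 ⟨r, h⟩)
          omega) (fun r h h' => absurd h h')
        (Or.inr (by
          obtain ⟨r, hr, h⟩ := hcase
          exact ⟨r, hr, by rwa [coeff_X_mul]⟩))
      rw [hLc, Finset.card_empty] at hd1
      have h2 := polyWeight_two (G.mulVec u) m (d + 1) (by have := hmin d hd; omega)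
      omega
    · push Not at hcase
      have hLd : ∀ r, r ∉ R → (u r).coeff d = 0 := by
        intro r hr
        apply hcase
        simpa [hL, hR] using hr
      have hRd : ∃ r ∈ R, (u r).coeff d ≠ 0 := by
        obtain ⟨r, hr⟩ := (hmem d).1 hd
        refine ⟨r, ?_, hr⟩
        by_contra h
        exact hr (hLd r h)
      rcases eq_or_ne m d with rfl | hmd
      · have h1 := hW2 u m R ∅ (Finset.empty_subset _) hLd (fun r _ _ => hprev r) (Or.inl hRd)
        have h2 := polyWeight_one (G.mulVec u) m
        rw [Finset.card_empty] at h1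
        omega
      · have h1 := hW2 u d R L (Finset.Subset.refl _) hLd (fun r h h' => absurd h h') (Or.inl hRd)
        have h2 := polyWeight_two (G.mulVec u) m d hmd
        omega
  have hinj : ∀ u : Fin k → Polynomial F, G.mulVec u = 0 → u = 0 := by
    intro u h
    by_contra hu
    have := hlow u hu
    rw [h] at this
    simp [polyWeight] at this
  refine ⟨hinj, ?_, ?_⟩
  · -- the degree
    set D : Fin k → ℕ := fun r => if (r : ℕ) < δ then 1 else 0 with hD
    have hDs : ∑ r, D r = δ := by
      rw [hD, ← Finset.card_filter, ← hL, hLc]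
    have hdeg : ∀ x r, (G x r).natDegree ≤ D r := by
      intro x r
      rw [hG, hD]
      dsimp only
      split_ifs
      · refine (natDegree_add_le _ _).trans (max_le (by simp) ?_)
        exact (natDegree_C_mul_le _ _).trans natDegree_X_le
      · simp
    refine le_antisymm ?_ ?_
    · refine Finset.sup_le fun f _ => ?_
      rw [← hDs]
      exact (det_deg_aux (G.submatrix f id) D fun i j => hdeg _ _).1
    · refine le_trans ?_ (Finset.le_sup (Finset.mem_univ (Fin.castLE hkn.le)))
      apply le_natDegree_of_ne_zero
      have h1 := (det_deg_aux (G.submatrix (Fin.castLE hkn.le) id) D fun i j => hdeg _ _).2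
      rw [hDs] at h1
      rw [h1]
      intro h0
      obtain ⟨w, hw, hw0⟩ := Matrix.exists_mulVec_eq_zero_iff.2 h0
      have hw' : (∃ r ∈ R, w r ≠ 0) ∨ (∃ r ∈ L, w r ≠ 0) := by
        obtain ⟨r, hr⟩ := Function.ne_iff.1 hw
        by_cases h : (r : ℕ) < δ
        · exact Or.inr ⟨r, by simpa [hL] using h, hr⟩
        · exact Or.inl ⟨r, by simpa [hR] using h, hr⟩
      have h2 := W R L w w (fun r hr => (Finset.mem_filter.1 hr).2) hw'
      have h3 : (univ.filter fun x : Fin n =>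
        ∑ r ∈ R, w r * c x (e0 r) + ∑ r ∈ L, w r * c x (2 * (r : ℕ) + 1) ≠ 0) ⊆
          univ.filter fun x : Fin n => ¬ (x : ℕ) < k := by
        intro x hx
        rw [Finset.mem_filter] at hx ⊢
        refine ⟨hx.1, fun hxk => hx.2 ?_⟩
        have h4 := congrFun hw0 ⟨x, hxk⟩
        rw [Matrix.mulVec, dotProduct, Pi.zero_apply] at h4
        rw [← h4, add_comm, hL, hR, Finset.sum_filter, Finset.sum_filter, ← Finset.sum_add_distrib]
        refine Finset.sum_congr rfl fun r _ => ?_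
        simp only [Matrix.of_apply, Matrix.submatrix_apply, id]
        rw [hG, hD]
        by_cases hr : (r : ℕ) < δ
        · simp only [hr, if_true, not_true_eq_false, if_false, add_zero, coeff_add, coeff_C_mul,
            coeff_X_one, coeff_C, one_ne_zero, zero_add, mul_one]
          exact mul_comm _ _
        · simp only [hr, if_false, not_false_eq_true, if_true, zero_add, coeff_add, zero_mul,
            coeff_C_zero, coeff_zero, add_zero, he0]
          exact mul_comm _ _
      have h5 := Finset.card_le_card h3
      have h6 := Finset.card_filter_add_card_filter_not (s := (univ : Finset (Fin n)))
        (fun x : Fin n => (x : ℕ) < k)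
      rw [Finset.card_univ, Fintype.card_fin, Fin.card_filter_val_lt, min_eq_right hkn.le] at h6
      omega
  · -- the free distance
    have hex : ∃ u : Fin k → F[X], G.mulVec u ≠ 0 ∧ polyWeight (G.mulVec u) ≤ n - k + δ + 1 := by
      let A : Matrix (Fin (k - δ - 1)) (Fin (k - δ)) F := fun i j => c i (δ + (δ + j))
      obtain ⟨w, hw, hw0⟩ : ∃ w : Fin (k - δ) → F, w ≠ 0 ∧ A.mulVec w = 0 := by
        have hni : ¬ Function.Injective A.mulVecLin := by
          intro h
          have := LinearMap.finrank_le_finrank_of_injective h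
          simp at this
          omega
        rw [← LinearMap.ker_eq_bot, Submodule.eq_bot_iff] at hni
        push Not at hni
        obtain ⟨w, h1, h2⟩ := hni
        exact ⟨w, h2, h1⟩
      let u : Fin k → F[X] := fun r =>
        if h : (r : ℕ) < δ then 0 else C (w ⟨r - δ, by omega⟩)
      have hu : u ≠ 0 := by
        obtain ⟨j, hj⟩ := Function.ne_iff.1 hw
        intro h
        have h1 := congrFun h ⟨δ + j, by omega⟩
        simp [u] at h1
        exact hj h1
      refine ⟨u, fun h => hu (hinj u h), ?_⟩
      have hc0 : ∀ x, G.mulVec u x = C (∑ j : Fin (k - δ), c x (δ + (δ + j)) * w j) := by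
        intro x
        rw [Matrix.mulVec, dotProduct, map_sum]
        symm
        refine Finset.sum_of_injOn (fun j : Fin (k - δ) => (⟨δ + j, by omega⟩ : Fin k)) ?_ ?_ ?_ ?_
        · intro i _ j _ h
          simpa [Fin.ext_iff] using h
        · intro i _
          simp
        · intro r _ hr
          have hrδ : (r : ℕ) < δ := by
            by_contra h
            refine hr ⟨⟨r - δ, by omega⟩, by simp, ?_⟩
            apply Fin.ext
            simp only
            omega
          simp [u, hrδ]
        · intro j _
          rw [hG]
          simp [u]
      have hle : polyWeight (G.mulVec u) ≤ (univ.filter fun x : Fin n => ¬ (x : ℕ) < k - δ - 1).card := by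
        rw [Finset.card_filter]
        refine Finset.sum_le_sum fun x _ => ?_
        rw [hc0]
        by_cases h : (x : ℕ) < k - δ - 1
        swap
        · rw [if_pos h]
          exact (Finset.card_le_card (support_C_subset _)).trans (by simp)
        · rw [if_neg (not_not.2 h)]
          have h4 := congrFun hw0 ⟨x, h⟩
          rw [Matrix.mulVec, dotProduct, Pi.zero_apply] at h4
          simp only [A] at h4
          rw [h4]
          simp
      have h6 := Finset.card_filter_add_card_filter_not (s := (univ : Finset (Fin n)))
        (fun x : Fin n => (x : ℕ) < k - δ - 1)
      rw [Finset.card_univ, Fintype.card_fin, Fin.card_filter_val_lt,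
        min_eq_right (by omega : k - δ - 1 ≤ n)] at h6
      omega
    obtain ⟨u, hu, hle⟩ := hex
    refine le_antisymm (le_trans (Nat.sInf_le (by exact ⟨u, hu, rfl⟩)) hle) ?_
    refine le_csInf ⟨_, u, hu, rfl⟩ ?_
    rintro _ ⟨u', hu', rfl⟩
    refine hlow u' ?_
    rintro rfl
    exact hu' (Matrix.mulVec_zero G)
end
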